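/- Let p ∈ ℂ[x] be nonzero with n = deg p, let ε = (−1)^n, and suppose c ∈ ℂ satisfies p(x) = ε·p(−x + c) for all x. Then for each choice of sign, the ℂ-linear map σ_± : 𝒟ᵃ_p → 𝒟ᵃ_p determined by σ_±(t^k f(D)p(D)) = ε·(±1)^k·t^k f(−D − k + c)p(D) (k ∈ ℤ, f ∈ ℂ[x]) is a well-defined anti-involution of 𝒟ᵃ_p preserving the principal ℤ-gradation. -/

import Mathlib

noncomputable section

/-- ℂ[t,t⁻¹] as a ℂ-vector space with basis {t^j}_{j∈ℤ}; t^j is `Finsupp.single j 1`. -/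
abbrev LaurentV : Type := ℤ →₀ ℂ

/-- The regular differential operator `t^k f(D)` (where D = t·d/dt), acting by
t^j ↦ f(j)·t^{j+k}. -/
def op (k : ℤ) (f : Polynomial ℂ) : Module.End ℂ LaurentV :=
  Finsupp.lsum ℂ fun j => f.eval (j : ℂ) • Finsupp.lsingle (j + k)

/-- The graded piece (𝒟ᵃ_p)_j = {t^j f(D) p(D) : f ∈ ℂ[x]}. -/
def Dgrade (p : Polynomial ℂ) (j : ℤ) : Submodule ℂ (Module.End ℂ LaurentV) :=
  Submodule.span ℂ {A | ∃ f : Polynomial ℂ, A = op j (f * p)}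

/-- 𝒟ᵃ_p = 𝒟ᵃ·p(D). -/
def Dp (p : Polynomial ℂ) : Submodule ℂ (Module.End ℂ LaurentV) :=
  Submodule.span ℂ {A | ∃ (k : ℤ) (f : Polynomial ℂ), A = op k (f * p)}

/-- σ is an anti-involution: it is ℂ-linear (built into the type), involutive, and
reverses products. -/
def IsAntiInvolutionOn (p : Polynomial ℂ) (σ : ↥(Dp p) →ₗ[ℂ] ↥(Dp p)) : Prop :=
  (∀ A : ↥(Dp p), σ (σ A) = A) ∧
  (∀ A B W : ↥(Dp p),
    (W : Module.End ℂ LaurentV) = (A : Module.End ℂ LaurentV) * (B : Module.End ℂ LaurentV) →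
    ((σ W : Module.End ℂ LaurentV)) = (σ B : Module.End ℂ LaurentV) * (σ A : Module.End ℂ LaurentV))

/-- σ preserves the principal ℤ-gradation. -/
def PreservesGrading (p : Polynomial ℂ) (σ : ↥(Dp p) →ₗ[ℂ] ↥(Dp p)) : Prop :=
  ∀ (j : ℤ) (A : ↥(Dp p)), (A : Module.End ℂ LaurentV) ∈ Dgrade p j →
    ((σ A : Module.End ℂ LaurentV)) ∈ Dgrade p j

/-- σ(t^k f(D) p(D)) = (-1)^{deg p}·e^k·t^k f(−D−k+c)p(D). -/
def SigmaFormula (p : Polynomial ℂ) (c e : ℂ) (σ : ↥(Dp p) →ₗ[ℂ] ↥(Dp p)) : Prop :=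
  ∀ (k : ℤ) (f : Polynomial ℂ) (A : ↥(Dp p)), (A : Module.End ℂ LaurentV) = op k (f * p) →
    ((σ A : Module.End ℂ LaurentV)) =
      ((-1 : ℂ) ^ p.natDegree * e ^ k) •
        op k ((f.comp (Polynomial.C (c - (k : ℂ)) - Polynomial.X)) * p)

/-- The graded piece (𝒟_p^±)_k = {d ∈ (𝒟_p)_k : σ_±(d) = −d}, as a set. -/
def DpmGradeSet (p : Polynomial ℂ) (c e : ℂ) (k : ℤ) : Set (Module.End ℂ LaurentV) :=
  {A | ∃ f : Polynomial ℂ, A = op k (f * p) ∧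
    ((-1 : ℂ) ^ p.natDegree * e ^ k) •
      op k ((f.comp (Polynomial.C (c - (k : ℂ)) - Polynomial.X)) * p) = -A}

/-- The graded piece (𝒟_p^±)_k, as a ℂ-subspace. -/
def DpmGrade (p : Polynomial ℂ) (c e : ℂ) (k : ℤ) : Submodule ℂ (Module.End ℂ LaurentV) :=
  Submodule.span ℂ (DpmGradeSet p c e k)

/-- V has finite codimension in W. -/
def FinCodimIn {M : Type*} [AddCommGroup M] [Module ℂ M] (V W : Submodule ℂ M) : Prop :=
  FiniteDimensional ℂ (↥W ⧸ Submodule.comap W.subtype V)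
theorem op_single (k : ℤ) (f : Polynomial ℂ) (j : ℤ) (a : ℂ) :
    op k f (Finsupp.single j a) = Finsupp.single (j + k) (f.eval (j : ℂ) * a) := by
  simp [op, -Finsupp.single_mul]

/-- The linear map `f ↦ t^k f(D) p(D)`. -/
def opMulHom (p : Polynomial ℂ) (k : ℤ) :
    Polynomial ℂ →ₗ[ℂ] Module.End ℂ LaurentV where
  toFun f := op k (f * p)
  map_add' f g := by
    refine Finsupp.lhom_ext fun j a => ?_
    simp [op_single, add_mul, Finsupp.single_add, -Finsupp.single_mul]
  map_smul' a f := by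
    refine Finsupp.lhom_ext fun j b => ?_
    simp [op_single, mul_assoc, -Finsupp.single_mul]

theorem opMulHom_apply (p f : Polynomial ℂ) (k : ℤ) : opMulHom p k f = op k (f * p) := rfl

theorem op_mul_op (k l : ℤ) (f g : Polynomial ℂ) :
    op k f * op l g = op (k + l) (f.comp (Polynomial.X + Polynomial.C (l : ℂ)) * g) := by
  refine Finsupp.lhom_ext fun j a => ?_
  simp [op_single, Module.End.mul_apply, mul_assoc, add_assoc, add_comm k l,
    -Finsupp.single_mul]

/-- The linear map sending a finitely supported family `(f_k)` to `∑ t^k f_k(D) p(D)`. -/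
def opSum (p : Polynomial ℂ) : (ℤ →₀ Polynomial ℂ) →ₗ[ℂ] Module.End ℂ LaurentV :=
  Finsupp.lsum ℂ (opMulHom p)

theorem opSum_single (p : Polynomial ℂ) (k : ℤ) (f : Polynomial ℂ) :
    opSum p (Finsupp.single k f) = op k (f * p) := by
  rw [opSum, Finsupp.lsum_single, opMulHom_apply]

theorem opSum_apply_single (p : Polynomial ℂ) (F : ℤ →₀ Polynomial ℂ) (j k : ℤ) :
    opSum p F (Finsupp.single j 1) (j + k) = (F k * p).eval (j : ℂ) := by
  induction F using Finsupp.induction_linear with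
  | zero => simp
  | add F G hF hG => simp [hF, hG, add_mul]
  | single l f =>
    rw [opSum_single, op_single]
    by_cases h : l = k <;> simp [h]

theorem Polynomial.eq_zero_of_eval_intCast {f : Polynomial ℂ}
    (h : ∀ j : ℤ, f.eval (j : ℂ) = 0) : f = 0 :=
  f.eq_zero_of_infinite_isRoot <|
    (Set.infinite_range_of_injective (Int.cast_injective (α := ℂ))).mono <| by
      rintro _ ⟨j, rfl⟩
      exact h j

theorem opSum_injective {p : Polynomial ℂ} (hp : p ≠ 0) : Function.Injective (opSum p) := by
  rw [injective_iff_map_eq_zero]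
  intro F hF
  ext1 k
  have h : F k * p = 0 := Polynomial.eq_zero_of_eval_intCast fun j => by
    rw [← opSum_apply_single, hF]
    rfl
  simpa [hp] using h

theorem range_opSum (p : Polynomial ℂ) : LinearMap.range (opSum p) = Dp p := by
  apply le_antisymm
  · rintro _ ⟨F, rfl⟩
    induction F using Finsupp.induction_linear with
    | zero => simp
    | add F G hF hG => rw [map_add]; exact add_mem hF hG
    | single k f => exact Submodule.subset_span ⟨k, f, opSum_single p k f⟩
  · refine Submodule.span_le.2 ?_
    rintro _ ⟨k, f, rfl⟩
    exact ⟨Finsupp.single k f, opSum_single p k f⟩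

/-- The coordinates of the elements of `𝒟ᵃ_p` with respect to the operators `t^k f(D) p(D)`. -/
def opEquiv {p : Polynomial ℂ} (hp : p ≠ 0) : (ℤ →₀ Polynomial ℂ) ≃ₗ[ℂ] Dp p :=
  (LinearEquiv.ofInjective (opSum p) (opSum_injective hp)).trans
    (LinearEquiv.ofEq _ _ (range_opSum p))

theorem coe_opEquiv {p : Polynomial ℂ} (hp : p ≠ 0) (F : ℤ →₀ Polynomial ℂ) :
    (opEquiv hp F : Module.End ℂ LaurentV) = opSum p F := rfl

/-- The map `(f_k(x)) ↦ (ε e^k f_k(-x - k + c))` describing `σ_±` in coordinates. -/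
def reflectCoord (ε c e : ℂ) : (ℤ →₀ Polynomial ℂ) →ₗ[ℂ] (ℤ →₀ Polynomial ℂ) :=
  Finsupp.lsum ℂ fun k => (ε * e ^ k) • (Finsupp.lsingle k).comp
    (Polynomial.aeval (Polynomial.C (c - (k : ℂ)) - Polynomial.X)).toLinearMap

theorem reflectCoord_single (ε c e : ℂ) (k : ℤ) (f : Polynomial ℂ) :
    reflectCoord ε c e (Finsupp.single k f) = Finsupp.single k
      ((ε * e ^ k) • f.comp (Polynomial.C (c - (k : ℂ)) - Polynomial.X)) := by
  simp [reflectCoord, Polynomial.comp_eq_aeval]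

theorem opSum_reflectCoord_single (p : Polynomial ℂ) (ε c e : ℂ) (k : ℤ) (f : Polynomial ℂ) :
    opSum p (reflectCoord ε c e (Finsupp.single k f)) =
      (ε * e ^ k) • op k (f.comp (Polynomial.C (c - (k : ℂ)) - Polynomial.X) * p) := by
  rw [reflectCoord_single, ← Finsupp.smul_single, map_smul, opSum_single]

theorem reflectCoord_reflectCoord {ε e : ℂ} (hε : ε * ε = 1) (he : e * e = 1) (c : ℂ)
    (F : ℤ →₀ Polynomial ℂ) : reflectCoord ε c e (reflectCoord ε c e F) = F := by
  induction F using Finsupp.induction_linear with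
  | zero => simp
  | add F G hF hG => rw [map_add, map_add, hF, hG]
  | single k f =>
    have hk : ε * e ^ k * (ε * e ^ k) = 1 := by
      rw [mul_mul_mul_comm, hε, ← mul_zpow, he, one_zpow, one_mul]
    rw [reflectCoord_single, ← Finsupp.smul_single, map_smul, reflectCoord_single,
      ← Finsupp.smul_single, smul_smul, hk, one_smul, Polynomial.comp_assoc]
    simp

theorem exists_opSum_eq_mul {p : Polynomial ℂ} {ε c e : ℂ} (hε : ε * ε = 1) (he : e ≠ 0)
    (hpc : ∀ x : ℂ, p.eval x = ε * p.eval (-x + c)) (F G : ℤ →₀ Polynomial ℂ) :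
    ∃ H, opSum p H = opSum p F * opSum p G ∧
      opSum p (reflectCoord ε c e H) =
        opSum p (reflectCoord ε c e G) * opSum p (reflectCoord ε c e F) := by
  induction F using Finsupp.induction_linear with
  | zero => exact ⟨0, by simp⟩
  | add F₁ F₂ h₁ h₂ =>
    obtain ⟨H₁, h₁, h₁'⟩ := h₁
    obtain ⟨H₂, h₂, h₂'⟩ := h₂
    exact ⟨H₁ + H₂, by simp only [map_add, h₁, h₂, add_mul],
      by simp only [map_add, h₁', h₂', mul_add]⟩
  | single k f =>
    induction G using Finsupp.induction_linear with
    | zero => exact ⟨0, by simp⟩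
    | add G₁ G₂ h₁ h₂ =>
      obtain ⟨H₁, h₁, h₁'⟩ := h₁
      obtain ⟨H₂, h₂, h₂'⟩ := h₂
      exact ⟨H₁ + H₂, by simp only [map_add, h₁, h₂, mul_add],
        by simp only [map_add, h₁', h₂', add_mul]⟩
    | single l g =>
      refine ⟨Finsupp.single (k + l)
        ((f * p).comp (Polynomial.X + Polynomial.C (l : ℂ)) * g), ?_, ?_⟩
      · rw [opSum_single, opSum_single, opSum_single, op_mul_op, mul_assoc]
      · rw [opSum_reflectCoord_single, opSum_reflectCoord_single, opSum_reflectCoord_single,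
          smul_mul_smul_comm, op_mul_op, add_comm l k]
        refine Finsupp.lhom_ext fun j a => ?_
        have hj := hpc (j + k)
        have h₁ : c - ((k : ℂ) + l) - j + l = -(j + k) + c := by ring
        have h₂ : c - (k : ℂ) - j = -(j + k) + c := by ring
        have h₃ : c - (l : ℂ) - (j + k) = c - (k + l) - j := by ring
        simp only [LinearMap.smul_apply, op_single, Finsupp.smul_single, smul_eq_mul,
          Polynomial.eval_mul, Polynomial.eval_comp, Polynomial.eval_add, Polynomial.eval_sub,
          Polynomial.eval_X, Polynomial.eval_C, Int.cast_add, zpow_add₀ he, h₁, h₂, h₃, hj]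
        congr 1
        linear_combination
          (-(ε * e ^ k * e ^ l * f.eval (-(j + k) + c) * p.eval (-(j + k) + c) *
            g.eval (c - (k + l) - j) * p.eval (j : ℂ) * a)) * hε

theorem exists_eq_op_of_mem_Dgrade {p : Polynomial ℂ} {j : ℤ} {A : Module.End ℂ LaurentV}
    (hA : A ∈ Dgrade p j) : ∃ f : Polynomial ℂ, A = op j (f * p) := by
  have h : Dgrade p j ≤ LinearMap.range (opMulHom p j) := by
    refine Submodule.span_le.2 ?_
    rintro _ ⟨f, rfl⟩
    exact ⟨f, rfl⟩
  obtain ⟨f, hf⟩ := h hA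
  exact ⟨f, hf.symm⟩

theorem sigma_pm_is_antiinvolution (p : Polynomial ℂ) (hp : p ≠ 0) (c : ℂ)
    (hpc : ∀ x : ℂ, p.eval x = (-1 : ℂ) ^ p.natDegree * p.eval (-x + c))
    (e : ℂ) (he : e = 1 ∨ e = -1) :
    ∃ σ : ↥(Dp p) →ₗ[ℂ] ↥(Dp p),
      IsAntiInvolutionOn p σ ∧ PreservesGrading p σ ∧ SigmaFormula p c e σ := by
  have hε : (-1 : ℂ) ^ p.natDegree * (-1) ^ p.natDegree = 1 := by
    rw [← mul_pow]
    simp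
  have he₂ : e * e = 1 := by rcases he with rfl | rfl <;> norm_num
  have he₀ : e ≠ 0 := left_ne_zero_of_mul_eq_one he₂
  let E := opEquiv hp
  let S := reflectCoord ((-1) ^ p.natDegree) c e
  have hformula : SigmaFormula p c e (E.conj S) := by
    intro k f A hA
    have hA' : A = E (Finsupp.single k f) :=
      Subtype.ext (hA.trans (opSum_single p k f).symm)
    rw [hA', LinearEquiv.conj_apply_apply, E.symm_apply_apply, coe_opEquiv]
    exact opSum_reflectCoord_single p _ c e k f
  refine ⟨E.conj S, ⟨fun A => ?_, fun A B W hW => ?_⟩, fun j A hA => ?_, hformula⟩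
  · rw [LinearEquiv.conj_apply_apply, LinearEquiv.conj_apply_apply, E.symm_apply_apply,
      reflectCoord_reflectCoord hε he₂, E.apply_symm_apply]
  · obtain ⟨F, rfl⟩ := E.surjective A
    obtain ⟨G, rfl⟩ := E.surjective B
    obtain ⟨H, hH, hH'⟩ := exists_opSum_eq_mul hε he₀ hpc F G
    obtain rfl : W = E H := Subtype.ext (hW.trans hH.symm)
    simp only [LinearEquiv.conj_apply_apply, E.symm_apply_apply]
    exact hH'
  · obtain ⟨f, hf⟩ := exists_eq_op_of_mem_Dgrade hA
    rw [hformula j f A hf]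
    exact Submodule.smul_mem _ _ (Submodule.subset_span ⟨_, rfl⟩)

end
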